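/- (Closed form of the expected class diversity of Proposition 1.) For natural numbers N ≥ 1 and K ≥ 1, one has the identity (N+K−1) · Σ_{k=1}^{K} k·C(K,k)·C(N−1,k−1) = K·N·C(N+K−1,K−1); equivalently, the expected class diversity E(M|N) = Σ_{k=1}^{K} k·C(N−1,k−1)·C(K,k)/C(N+K−1,K−1) equals K·N/(N+K−1). This closed form reproduces the paper's numerical evaluations E(M|128) ≈ 9.34, E(M|200) ≈ 9.57 and E(M|2) ≈ 1.82 for K = 10. -/

import Mathlib

open Finset

/-- Vandermonde's identity in symmetric form. -/
theorem sum_range_choose_mul_choose (m n : ℕ) :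
    ∑ j ∈ Finset.range (m + 1), m.choose j * n.choose j = (n + m).choose m := by
  rw [Nat.add_choose_eq, Finset.Nat.sum_antidiagonal_eq_sum_range_succ_mk]
  refine Finset.sum_congr rfl fun j hj => ?_
  rw [Nat.choose_symm (Finset.mem_range_succ_iff.mp hj), mul_comm]

theorem sum_Icc_mul_choose_mul_choose (m n : ℕ) :
    ∑ k ∈ Finset.Icc 1 (m + 1), k * ((m + 1).choose k * n.choose (k - 1))
      = (m + 1) * (n + m).choose m := by
  rw [← sum_range_choose_mul_choose, Finset.mul_sum, ← Finset.Ico_add_one_right_eq_Icc,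
    Finset.sum_Ico_eq_sum_range]
  refine Finset.sum_congr rfl fun j _ => ?_
  rw [add_comm 1 j, Nat.add_sub_cancel]
  linear_combination n.choose j * (Nat.add_one_mul_choose_eq m j).symm

/-- (Closed form of the expected class diversity of Proposition 1.) For `N ≥ 1` and
`K ≥ 1`, `(N+K−1) · Σ_{k=1}^{K} k·C(K,k)·C(N−1,k−1) = K·N·C(N+K−1,K−1)`; equivalently,
the expected class diversity `E(M|N) = Σ_{k=1}^{K} k·C(N−1,k−1)·C(K,k)/C(N+K−1,K−1)`
equals `K·N/(N+K−1)`. -/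
theorem expected_class_diversity_closed_form (N K : ℕ) (hN : 1 ≤ N) (hK : 1 ≤ K) :
    (N + K - 1) * ∑ k ∈ Finset.Icc 1 K, k * (K.choose k * (N - 1).choose (k - 1))
        = K * N * (N + K - 1).choose (K - 1)
    ∧ ∑ k ∈ Finset.Icc 1 K,
          (k : ℝ) * ((N - 1).choose (k - 1) * K.choose k) / (N + K - 1).choose (K - 1)
        = (K * N : ℝ) / (N + K - 1) := by
  have key : (N + K - 1) * ∑ k ∈ Finset.Icc 1 K, k * (K.choose k * (N - 1).choose (k - 1))
      = K * N * (N + K - 1).choose (K - 1) := by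
    obtain ⟨n, rfl⟩ := Nat.exists_eq_add_of_le' hN
    obtain ⟨m, rfl⟩ := Nat.exists_eq_add_of_le' hK
    rw [show n + 1 + (m + 1) - 1 = n + m + 1 by lia, Nat.add_sub_cancel, Nat.add_sub_cancel,
      sum_Icc_mul_choose_mul_choose]
    have h := Nat.choose_mul_succ_eq (n + m) m
    rw [show n + m + 1 - m = n + 1 by lia] at h
    linear_combination (m + 1) * h
  refine ⟨key, ?_⟩
  have hcast : ((N + K - 1 : ℕ) : ℝ) = N + K - 1 := by
    rw [Nat.cast_sub (by lia)]
    push_cast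
    ring
  have hpos : (0 : ℝ) < N + K - 1 := by
    rw [← hcast]
    exact_mod_cast (by lia : 0 < N + K - 1)
  have hchoose : (0 : ℝ) < (N + K - 1).choose (K - 1) := by
    exact_mod_cast Nat.choose_pos (by lia)
  rw [← Finset.sum_div, div_eq_div_iff hchoose.ne' hpos.ne', ← hcast, mul_comm]
  simp_rw [mul_comm (((N - 1).choose _ : ℕ) : ℝ)]
  exact_mod_cast key
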